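/- arXiv:2505.19222 — 3 statements merged into one kernel-verified Lean document; each statement's English description precedes it below -/
import Mathlib

section
/- Let M be a real symmetric 2×2 matrix with entries M₁₁ = a, M₁₂ = M₂₁ = b, M₂₂ = c. Assume M is positive semidefinite, a ≥ c ≥ 0, and a + |b| > 0. Then for every vector v ∈ ℝ², the quadratic form satisfies vᵀ M v ≥ ((ac − b²)/(a + |b|))·‖v‖²; in particular the smallest eigenvalue of M is at least (ac − b²)/(a + |b|). -/
open Matrix

/-- Lower bound of Lemma A.1: for a real symmetric positive semidefinite `2×2` matrix
`M = !![a, b; b, c]` with `a ≥ c ≥ 0` and `a + |b| > 0`, the quadratic form is bounded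
below by `((ac − b²)/(a + |b|))‖v‖²`; in particular every eigenvalue of `M` is at least
`(ac − b²)/(a + |b|)`. -/
theorem quadratic_form_lower_bound (a b c : ℝ)
    (M : Matrix (Fin 2) (Fin 2) ℝ) (hM : M = !![a, b; b, c])
    (hpsd : M.PosSemidef) (hac : a ≥ c) (hc : c ≥ 0) (hpos : a + |b| > 0) :
    (∀ v : Fin 2 → ℝ,
      v ⬝ᵥ (M *ᵥ v) ≥ ((a * c - b ^ 2) / (a + |b|)) * (v 0 ^ 2 + v 1 ^ 2)) ∧
    (∀ (μ : ℝ) (v : Fin 2 → ℝ), v ≠ 0 → M *ᵥ v = μ • v →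
      μ ≥ (a * c - b ^ 2) / (a + |b|)) := by
  subst hM
  have hdet : 0 ≤ a * c - b ^ 2 := by
    have h := hpsd.det_nonneg
    rw [Matrix.det_fin_two_of] at h
    nlinarith
  have key : ∀ v : Fin 2 → ℝ, v ⬝ᵥ (!![a, b; b, c] *ᵥ v) ≥
      ((a * c - b ^ 2) / (a + |b|)) * (v 0 ^ 2 + v 1 ^ 2) := by
    intro v
    have hv : v ⬝ᵥ (!![a, b; b, c] *ᵥ v) =
        a * v 0 ^ 2 + 2 * b * (v 0 * v 1) + c * v 1 ^ 2 := by
      simp [Matrix.mulVec, dotProduct, Fin.sum_univ_two]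
      ring
    rw [hv, ge_iff_le, div_mul_eq_mul_div, div_le_iff₀ hpos]
    generalize v 0 = x
    generalize v 1 = y
    have hb : b ^ 2 = |b| ^ 2 := (sq_abs b).symm
    have hβ : 0 ≤ |b| := abs_nonneg b
    have ha : 0 ≤ a := le_trans hc hac
    set s := a + |b| with hs
    have hP : 0 ≤ s * a - (a * c - b ^ 2) := by
      have h1 : 0 ≤ a * (a - c) := mul_nonneg ha (sub_nonneg.2 hac)
      have h2 : 0 ≤ a * |b| := mul_nonneg ha hβ
      rw [hs]
      nlinarith [sq_nonneg b]
    have hR : 0 ≤ s * c - (a * c - b ^ 2) := by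
      have h2 : 0 ≤ c * |b| := mul_nonneg hc hβ
      rw [hs]
      nlinarith [sq_nonneg b]
    have hD : (s * b) ^ 2 ≤ (s * a - (a * c - b ^ 2)) * (s * c - (a * c - b ^ 2)) := by
      have h1 : 0 ≤ (a * c - b ^ 2) * ((a - c) * |b|) :=
        mul_nonneg hdet (mul_nonneg (sub_nonneg.2 hac) hβ)
      have h2 : (s * a - (a * c - b ^ 2)) * (s * c - (a * c - b ^ 2)) - (s * b) ^ 2
          = (a * c - b ^ 2) * ((a - c) * |b|) := by
        rw [mul_pow, hb, hs]
        ring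
      linarith
    have hS : 0 ≤ (s * a - (a * c - b ^ 2)) * x ^ 2 + (s * c - (a * c - b ^ 2)) * y ^ 2 := by
      positivity
    have hfin := abs_le_of_sq_le_sq (a := 2 * (s * b) * (x * y)) (by
      nlinarith [mul_le_mul_of_nonneg_right hD (sq_nonneg (x * y)),
        sq_nonneg ((s * a - (a * c - b ^ 2)) * x ^ 2 - (s * c - (a * c - b ^ 2)) * y ^ 2)]) hS
    linarith [(abs_le.1 hfin).1]
  refine ⟨key, fun μ v hv hμ => ?_⟩
  have h := key v
  have hn : 0 < v 0 ^ 2 + v 1 ^ 2 := by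
    by_contra hcon
    apply hv
    have h0 : v 0 = 0 := by nlinarith [sq_nonneg (v 0), sq_nonneg (v 1)]
    have h1 : v 1 = 0 := by nlinarith [sq_nonneg (v 0), sq_nonneg (v 1)]
    ext i
    fin_cases i
    · exact h0
    · exact h1
  have he : v ⬝ᵥ (μ • v) = μ * (v 0 ^ 2 + v 1 ^ 2) := by
    simp [dotProduct, Fin.sum_univ_two]
    ring
  rw [hμ, he] at h
  exact le_of_mul_le_mul_right h hn
end

section
/- Let δ ≥ 1, let A(δ) be as below, let B = diag(1, 1/(64δ²)) (i.e., B = diag(1, α²) with α = 1/(8δ)), and let ν = 1/(2δ). Then the matrix B − ν·A(δ) is positive definite and for every vector v ∈ ℝ², vᵀ (B − ν A(δ)) v ≥ (1/(228 δ²))·‖v‖²; in particular its smallest eigenvalue is at least 1/(228δ²). -/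
open Matrix

/-- The eigenvalue bound from the proof of Lemma 4.4 (mesh-dependent spectral gap):
for `δ ≥ 1`, with `B = diag(1, 1/(64δ²))` and `ν = 1/(2δ)`, the matrix `B − ν A(δ)`
is positive definite and its quadratic form is bounded below by `(1/(228δ²))‖v‖²`. -/
theorem B_sub_nu_A_posDef_lower_bound (δ : ℝ) (hδ : 1 ≤ δ)
    (A B : Matrix (Fin 2) (Fin 2) ℝ)
    (hA : A = !![1 / (8 * δ), 1 / (48 * δ ^ 2);
                 1 / (48 * δ ^ 2), 10 / (2304 * δ ^ 3)])
    (hB : B = !![1, 0; 0, 1 / (64 * δ ^ 2)]) (ν : ℝ) (hν : ν = 1 / (2 * δ)) :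
    (B - ν • A).PosDef ∧
    ∀ v : Fin 2 → ℝ,
      v ⬝ᵥ ((B - ν • A) *ᵥ v) ≥ (1 / (228 * δ ^ 2)) * (v 0 ^ 2 + v 1 ^ 2) := by
  have hpos : 0 < δ := by linarith
  obtain ⟨t, ht⟩ : ∃ t, t = δ⁻¹ := ⟨_, rfl⟩
  have ht0 : 0 < t := by rw [ht]; positivity
  have ht1 : t ≤ 1 := by rw [ht]; exact inv_le_one_of_one_le₀ hδ
  have hM : B - ν • A = !![1 - t ^ 2 / 16, -(t ^ 3 / 96);
      -(t ^ 3 / 96), t ^ 2 / 64 - 10 * t ^ 4 / 4608] := by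
    subst hA hB hν ht
    ext i j
    fin_cases i <;> fin_cases j <;> simp <;> field_simp <;> ring
  have hc : 1 / (228 * δ ^ 2) = t ^ 2 / 228 := by
    rw [ht]; field_simp
  have key : ∀ v : Fin 2 → ℝ,
      v ⬝ᵥ ((B - ν • A) *ᵥ v) ≥ (1 / (228 * δ ^ 2)) * (v 0 ^ 2 + v 1 ^ 2) := by
    intro v
    rw [hM, hc]
    simp only [dotProduct, mulVec, Fin.sum_univ_two, of_apply, cons_val', cons_val_zero,
      cons_val_one, cons_val_fin_one]
    generalize v 0 = x
    generalize v 1 = y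
    have hs : 0 ≤ 1 - t ^ 2 := by nlinarith
    have h0 : 0 ≤ x ^ 2 + (1 / 64 - 1 / 228) * (t * y) ^ 2 := by nlinarith [sq_nonneg x, sq_nonneg (t * y)]
    have h1 : 0 ≤ (1 - 1 / 16 - 1 / 228) * x ^ 2 - 1 / 48 * x * (t * y)
        + (1 / 64 - 10 / 4608 - 1 / 228) * (t * y) ^ 2 := by
      nlinarith [sq_nonneg (x - t * y / 48), sq_nonneg (t * y), sq_nonneg x]
    nlinarith [mul_nonneg hs h0, mul_nonneg (sq_nonneg t) h1]
  refine ⟨?_, key⟩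
  refine PosDef.of_dotProduct_mulVec_pos ?_ ?_
  · rw [hM]
    ext i j
    fin_cases i <;> fin_cases j <;> simp
  · intro v hv
    have h := key v
    rw [star_trivial]
    refine lt_of_lt_of_le ?_ h
    have hne : 0 < v 0 ^ 2 + v 1 ^ 2 := by
      by_contra hcon
      apply hv
      have a0 : v 0 = 0 := by nlinarith [sq_nonneg (v 0), sq_nonneg (v 1)]
      have a1 : v 1 = 0 := by nlinarith [sq_nonneg (v 0), sq_nonneg (v 1)]
      ext i
      fin_cases i
      · exact a0
      · exact a1
    positivity
end

section
/- Let n ≥ 1 be a natural number, let L > 0, let P be a real polynomial in one variable of degree at most n, and let s be a Lebesgue-measurable subset of the interval [0, L] whose Lebesgue measure is at most L/(64 n²). Then ∫_{[0,L]} P(t)² dt ≤ 2·∫_{[0,L] \ s} P(t)² dt; equivalently, ∫_{[0,L] \ s} P² ≥ (1/2)·∫_{[0,L]} P². -/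
open MeasureTheory

lemma aux_endpoint_deriv (n : ℕ) (P : Polynomial ℝ) (hP : P.natDegree ≤ n) (a b M : ℝ)
    (hM : 0 < M) (hb : ∀ x ∈ Set.uIcc a b, |P.eval x| ≤ M) :
    (b - a) * P.derivative.eval b ≤ 2 * M * (n : ℝ) ^ 2 := by
  set Q : Polynomial ℝ := Polynomial.C (1 / M) *
    P.comp (Polynomial.C ((b - a) / 2) * Polynomial.X + Polynomial.C ((a + b) / 2)) with hQ
  have hdeg : Q.degree ≤ n := by
    apply Polynomial.natDegree_le_iff_degree_le.mp
    refine (Polynomial.natDegree_C_mul_le _ _).trans ?_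
    refine Polynomial.natDegree_comp_le.trans ?_
    calc _ ≤ P.natDegree * 1 := Nat.mul_le_mul_left _ Polynomial.natDegree_linear_le
      _ ≤ n := by simpa using hP
  have hbnd : ∀ x ∈ Set.Icc (-1 : ℝ) 1, |Q.eval x| ≤ 1 := by
    intro x hx
    have h1 := hb ((b - a) / 2 * x + (a + b) / 2) (by
      rw [Set.mem_uIcc]
      rcases le_total a b with h | h
      · left; constructor <;> nlinarith [hx.1, hx.2]
      · right; constructor <;> nlinarith [hx.1, hx.2])
    simp only [hQ, Polynomial.eval_mul, Polynomial.eval_C, Polynomial.eval_comp,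
      Polynomial.eval_add, Polynomial.eval_X]
    rw [abs_mul, abs_of_pos (by positivity : 0 < 1 / M), one_div, inv_mul_le_iff₀ hM]
    simpa using h1
  have key := Polynomial.Chebyshev.eval_iterate_derivative_le_of_forall_abs_le_one
    (k := 1) (le_refl (1 : ℝ)) hdeg hbnd
  have hT : (Polynomial.derivative (Polynomial.Chebyshev.T ℝ n)).eval 1 = (n : ℝ) ^ 2 := by
    simp [Polynomial.Chebyshev.T_derivative_eq_U]
    try ring
  have hd : Q.derivative.eval 1 = 1 / M * ((b - a) / 2 * P.derivative.eval b) := by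
    simp only [hQ, Polynomial.derivative_C_mul, Polynomial.derivative_comp]
    simp
    left; left
    congr 1; ring
  simp only [Function.iterate_one] at key
  rw [hT, hd, one_div, inv_mul_le_iff₀ hM] at key
  linarith

lemma aux_endpoint_deriv_abs (n : ℕ) (P : Polynomial ℝ) (hP : P.natDegree ≤ n) (a b M : ℝ)
    (hM : 0 < M) (hb : ∀ x ∈ Set.uIcc a b, |P.eval x| ≤ M) :
    |b - a| * |P.derivative.eval b| ≤ 2 * M * (n : ℝ) ^ 2 := by
  rw [← abs_mul]
  refine abs_le'.mpr ⟨aux_endpoint_deriv n P hP a b M hM hb, ?_⟩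
  have := aux_endpoint_deriv n (-P) (by simpa using hP) a b M hM (by simpa using hb)
  simpa using this

lemma aux_deriv_bound (n : ℕ) (P : Polynomial ℝ) (hP : P.natDegree ≤ n) (L M : ℝ) (hL : 0 < L)
    (hM : 0 < M) (hb : ∀ x ∈ Set.Icc 0 L, |P.eval x| ≤ M) (y : ℝ) (hy : y ∈ Set.Icc 0 L) :
    |P.derivative.eval y| ≤ 4 * M * (n : ℝ) ^ 2 / L := by
  rw [le_div_iff₀ hL]
  have h0 : (0:ℝ) ≤ |P.derivative.eval y| := abs_nonneg _
  have hz : ∀ a ∈ Set.Icc 0 L, L / 2 ≤ |y - a| →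
      |P.derivative.eval y| * L ≤ 4 * M * (n : ℝ) ^ 2 := by
    intro a ha h
    have := aux_endpoint_deriv_abs n P hP a y M hM
      (fun x hx => hb x (Set.uIcc_subset_Icc ha hy hx))
    nlinarith [mul_le_mul_of_nonneg_right h h0]
  rcases le_total (L / 2) y with h | h
  · exact hz 0 ⟨le_rfl, hL.le⟩ (by simpa using h.trans (le_abs_self y))
  · exact hz L ⟨hL.le, le_rfl⟩ (by rw [abs_sub_comm]; exact le_trans (by linarith) (le_abs_self _))

lemma aux_sup (n : ℕ) (hn : 1 ≤ n) (P : Polynomial ℝ) (hP : P.natDegree ≤ n) (L M : ℝ)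
    (hL : 0 < L) (hM : 0 ≤ M) (hb : ∀ x ∈ Set.Icc 0 L, |P.eval x| ≤ M)
    (x₀ : ℝ) (hx₀ : x₀ ∈ Set.Icc 0 L) (hx : |P.eval x₀| = M) :
    M ^ 2 * (L / (32 * (n : ℝ) ^ 2)) ≤ ∫ t in Set.Icc 0 L, P.eval t ^ 2 := by
  rcases hM.eq_or_lt with h0 | hM
  · rw [← h0]; simp only [ne_eq, OfNat.ofNat_ne_zero, not_false_eq_true, zero_pow, zero_mul]
    exact integral_nonneg fun t => sq_nonneg _
  have hn' : (1:ℝ) ≤ n := by exact_mod_cast hn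
  have hn2 : (1:ℝ) ≤ (n:ℝ) ^ 2 := by nlinarith
  set h : ℝ := L / (8 * (n : ℝ) ^ 2) with hh
  have hhpos : 0 < h := by positivity
  have hhL : h ≤ L / 2 := by
    rw [hh, div_le_div_iff₀ (by positivity) (by norm_num)]; nlinarith
  have hint : IntegrableOn (fun t => P.eval t ^ 2) (Set.Icc 0 L) :=
    (P.continuous.pow 2).continuousOn.integrableOn_Icc
  have hlow : ∀ y ∈ Set.Icc 0 L, |y - x₀| ≤ h → (M / 2) ^ 2 ≤ P.eval y ^ 2 := by
    intro y hy hyx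
    have := (convex_Icc (0:ℝ) L).norm_image_sub_le_of_norm_hasDerivWithin_le
      (f := fun x => P.eval x) (f' := fun x => P.derivative.eval x)
      (C := 4 * M * (n : ℝ) ^ 2 / L)
      (fun x _ => (P.hasDerivAt x).hasDerivWithinAt)
      (fun x hx => aux_deriv_bound n P hP L M hL hM hb x hx) hx₀ hy
    simp only [Real.norm_eq_abs] at this
    have h2 : 4 * M * (n : ℝ) ^ 2 / L * |y - x₀| ≤ M / 2 := by
      calc _ ≤ 4 * M * (n : ℝ) ^ 2 / L * h := by gcongr
        _ = M / 2 := by rw [hh]; field_simp; norm_num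
    have h3 : M / 2 ≤ |P.eval y| := by
      have := abs_sub_abs_le_abs_sub (P.eval x₀) (P.eval y)
      rw [abs_sub_comm] at this
      linarith
    rw [← sq_abs (P.eval y)]
    gcongr
  have hmain : ∀ c, 0 ≤ c → c + h ≤ L → c ≤ x₀ → x₀ ≤ c + h →
      M ^ 2 * (L / (32 * (n : ℝ) ^ 2)) ≤ ∫ t in Set.Icc 0 L, P.eval t ^ 2 := by
    intro c h1 h2 h3 h4
    have hsub : Set.Icc c (c + h) ⊆ Set.Icc 0 L := Set.Icc_subset_Icc h1 h2
    calc M ^ 2 * (L / (32 * (n : ℝ) ^ 2)) = ∫ t in Set.Icc c (c + h), (M / 2) ^ 2 := by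
          simp [hhpos.le]; rw [hh]; field_simp; norm_num
      _ ≤ ∫ t in Set.Icc c (c + h), P.eval t ^ 2 := by
          refine setIntegral_mono_on (by simp) (hint.mono_set hsub) measurableSet_Icc ?_
          intro y hy
          exact hlow y (hsub hy) (abs_le.mpr ⟨by linarith [hy.1], by linarith [hy.2]⟩)
      _ ≤ _ := setIntegral_mono_set hint (Filter.Eventually.of_forall fun t => sq_nonneg _)
          hsub.eventuallyLE
  rcases le_total x₀ (L / 2) with h' | h'
  · exact hmain x₀ hx₀.1 (by linarith) le_rfl (by linarith)
  · exact hmain (x₀ - h) (by linarith) (by linarith [hx₀.2]) (by linarith) (by linarith)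

/-- The estimate `‖w‖²_{e∖e₀} ≥ (1/2)‖w‖²_e` from the proof of Lemma 4.4
(mesh-dependent spectral gap): if `P` is a real polynomial of degree at most `n ≥ 1`
and `s ⊆ [0, L]` is a measurable set of Lebesgue measure at most `L/(64 n²)`, then
`∫_{[0,L]} P² ≤ 2 ∫_{[0,L]∖s} P²`. -/
theorem polynomial_square_integral_small_set (n : ℕ) (hn : 1 ≤ n) (L : ℝ) (hL : 0 < L)
    (P : Polynomial ℝ) (hP : P.natDegree ≤ n)
    (s : Set ℝ) (hs : MeasurableSet s) (hsub : s ⊆ Set.Icc 0 L)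
    (hmeas : volume s ≤ ENNReal.ofReal (L / (64 * (n : ℝ) ^ 2))) :
    ∫ t in Set.Icc 0 L, P.eval t ^ 2 ≤ 2 * ∫ t in Set.Icc 0 L \ s, P.eval t ^ 2 := by
  have hint : IntegrableOn (fun t => P.eval t ^ 2) (Set.Icc 0 L) :=
    (P.continuous.pow 2).continuousOn.integrableOn_Icc
  obtain ⟨x₀, hx₀, hmax⟩ := isCompact_Icc.exists_isMaxOn
    (Set.nonempty_Icc.mpr hL.le) (P.continuous.abs.continuousOn (s := Set.Icc 0 L))
  have hb : ∀ x ∈ Set.Icc 0 L, |P.eval x| ≤ |P.eval x₀| := fun x hx => hmax hx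
  have h1 := aux_sup n hn P hP L _ hL (abs_nonneg _) hb x₀ hx₀ rfl
  have hpos : 0 ≤ L / (64 * (n : ℝ) ^ 2) := by positivity
  have hfin : volume s < ⊤ := hmeas.trans_lt ENNReal.ofReal_lt_top
  have hvol : volume.real s ≤ L / (64 * (n : ℝ) ^ 2) :=
    ENNReal.toReal_le_of_le_ofReal hpos hmeas
  have h2 : ∫ t in s, P.eval t ^ 2 ≤ |P.eval x₀| ^ 2 * (L / (64 * (n : ℝ) ^ 2)) := by
    calc ∫ t in s, P.eval t ^ 2 ≤ ∫ t in s, |P.eval x₀| ^ 2 := by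
          refine setIntegral_mono_on (hint.mono_set hsub)
            (integrableOn_const hfin.ne) hs ?_
          intro y hy
          rw [← sq_abs (P.eval y)]
          have := hb y (hsub hy)
          gcongr
      _ = volume.real s * |P.eval x₀| ^ 2 := by simp
      _ ≤ _ := by rw [mul_comm]; gcongr
  have h3 := integral_diff hs hint hsub
  have h4 : L / (32 * (n : ℝ) ^ 2) = 2 * (L / (64 * (n : ℝ) ^ 2)) := by
    field_simp; norm_num
  rw [h4] at h1
  rw [h3]
  linarith
end
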